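/- For every nonnegative integer N and a ∈ {0,1}, the polynomial ∑_{j∈ℤ} χ(j+1) q^{j^2} [2N+a choose N−2j]_q has nonnegative coefficients, where χ is the Legendre symbol mod 3: χ(j) = 1 if j ≡ 1 (mod 3), χ(j) = −1 if j ≡ 2 (mod 3), χ(j) = 0 if j ≡ 0 (mod 3). -/

import Mathlib

open LaurentPolynomial Finset

noncomputable section

/-- The Gaussian binomial coefficient `[m choose n]_q` as a polynomial in `q`,
defined via the `q`-Pascal recurrence; it equals `(q;q)_m/((q;q)_n (q;q)_{m-n})`
for `0 ≤ n ≤ m`. -/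
def gb : ℕ → ℕ → Polynomial ℤ
  | _, 0 => 1
  | 0, _ + 1 => 0
  | m + 1, n + 1 => gb m n + Polynomial.X ^ (n + 1) * gb m (n + 1)

/-- `[m choose n]_q` with integer indices, zero unless `0 ≤ n ≤ m`,
viewed as a Laurent polynomial in `q`. -/
def qbin (m n : ℤ) : LaurentPolynomial ℤ :=
  if 0 ≤ n ∧ n ≤ m then (gb m.toNat n.toNat).toLaurent else 0

/-- A Laurent polynomial is a polynomial in `q` with nonnegative coefficients. -/
def IsNonneg (x : LaurentPolynomial ℤ) : Prop :=
  ∃ P : Polynomial ℤ, (∀ n, 0 ≤ P.coeff n) ∧ P.toLaurent = x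

/-- The triangular number `T(j) = j(j+1)/2`. -/
def tri (j : ℤ) : ℤ := j * (j + 1) / 2

/-- The Legendre symbol mod 3: `χ(j) = 1, -1, 0` according as `j ≡ 1, 2, 0 (mod 3)`. -/
def chi (j : ℤ) : ℤ := if j % 3 = 1 then 1 else if j % 3 = 2 then -1 else 0

namespace IsNonneg

lemma zero : IsNonneg 0 := ⟨0, by simp, by simp⟩

lemma one : IsNonneg 1 := by
  refine ⟨1, fun n => ?_, by simp⟩
  rw [Polynomial.coeff_one]
  split_ifs <;> simp

lemma add {x y : LaurentPolynomial ℤ} (hx : IsNonneg x) (hy : IsNonneg y) : IsNonneg (x + y) := by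
  obtain ⟨P, hP, rfl⟩ := hx
  obtain ⟨Q, hQ, rfl⟩ := hy
  exact ⟨P + Q, fun n => by simpa using add_nonneg (hP n) (hQ n), by simp⟩

lemma mul {x y : LaurentPolynomial ℤ} (hx : IsNonneg x) (hy : IsNonneg y) : IsNonneg (x * y) := by
  obtain ⟨P, hP, rfl⟩ := hx
  obtain ⟨Q, hQ, rfl⟩ := hy
  refine ⟨P * Q, fun n => ?_, by simp⟩
  rw [Polynomial.coeff_mul]
  exact Finset.sum_nonneg fun k _ => mul_nonneg (hP _) (hQ _)

lemma T_pow (n : ℕ) : IsNonneg (T 1 ^ n) := by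
  refine ⟨Polynomial.X ^ n, fun k => ?_, by simp⟩
  rw [Polynomial.coeff_X_pow]
  split_ifs <;> simp

lemma sum {ι : Type*} (s : Finset ι) (f : ι → LaurentPolynomial ℤ) (h : ∀ i ∈ s, IsNonneg (f i)) :
    IsNonneg (∑ i ∈ s, f i) :=
  Finset.sum_induction f IsNonneg (fun _ _ => add) zero h

end IsNonneg

section GaussianBinomial

lemma gb_zero_right (m : ℕ) : gb m 0 = 1 := by cases m <;> rfl

lemma gb_succ_succ (m n : ℕ) :
    gb (m + 1) (n + 1) = gb m n + Polynomial.X ^ (n + 1) * gb m (n + 1) := rfl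

lemma gb_eq_zero_of_lt {m n : ℕ} (h : m < n) : gb m n = 0 := by
  induction m generalizing n with
  | zero =>
    obtain ⟨k, rfl⟩ := Nat.exists_eq_add_of_lt h
    simp [gb]
  | succ m ih =>
    obtain ⟨k, rfl⟩ : ∃ k, n = k + 1 := ⟨n - 1, by omega⟩
    rw [gb_succ_succ, ih (by omega), ih (by omega)]
    simp

lemma gb_self (m : ℕ) : gb m m = 1 := by
  induction m with
  | zero => rfl
  | succ m ih => rw [gb_succ_succ, ih, gb_eq_zero_of_lt (by omega)]; simp

lemma gb_coeff_nonneg (m n k : ℕ) : 0 ≤ (gb m n).coeff k := by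
  induction m generalizing n k with
  | zero =>
    cases n with
    | zero => rw [gb_zero_right, Polynomial.coeff_one]; split_ifs <;> simp
    | succ n => simp [gb]
  | succ m ih =>
    cases n with
    | zero => rw [gb_zero_right, Polynomial.coeff_one]; split_ifs <;> simp
    | succ n =>
      rw [gb_succ_succ, Polynomial.coeff_add, Polynomial.coeff_X_pow_mul']
      have := ih n k
      split_ifs
      · exact add_nonneg this (ih _ _)
      · simpa using this

/-- The absorption identity `(1 - q^(n+1)) [m+1 choose n+1] = (1 - q^(m+1)) [m choose n]`. -/
lemma one_sub_X_pow_mul_gb (m n : ℕ) :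
    (1 - Polynomial.X ^ (n + 1)) * gb (m + 1) (n + 1) =
      (1 - Polynomial.X ^ (m + 1)) * gb m n := by
  induction m generalizing n with
  | zero =>
    cases n with
    | zero => simp [gb]
    | succ n => simp [gb]
  | succ m ih =>
    have h1 := ih n
    have h0 := gb_succ_succ (m + 1) n
    cases n with
    | zero =>
      simp only [gb_zero_right] at h1 h0 ⊢
      rw [h0]
      linear_combination Polynomial.X ^ 1 * h1
    | succ n =>
      have h2 := ih n
      have h3 := gb_succ_succ m n
      rw [h0]
      linear_combination Polynomial.X ^ (n + 2) * h1 + Polynomial.X * h2 +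
        Polynomial.X * (Polynomial.X ^ (m + 1) - 1) * h3

lemma gb_succ_succ' {m n : ℕ} (h : n ≤ m) :
    gb (m + 1) (n + 1) = Polynomial.X ^ (m - n) * gb m n + gb m (n + 1) := by
  have h1 := one_sub_X_pow_mul_gb m n
  rw [gb_succ_succ] at h1 ⊢
  obtain ⟨k, rfl⟩ := Nat.exists_eq_add_of_le h
  rw [Nat.add_sub_cancel_left]
  have hX : (Polynomial.X : Polynomial ℤ) ^ (n + 1) ≠ 0 := pow_ne_zero _ Polynomial.X_ne_zero
  refine mul_left_cancel₀ hX ?_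
  linear_combination -h1

lemma gb_symm (a b : ℕ) : gb (a + b) a = gb (a + b) b := by
  obtain ⟨s, hs⟩ : ∃ s, s = a + b := ⟨_, rfl⟩
  induction s generalizing a b with
  | zero =>
    obtain ⟨rfl, rfl⟩ : a = 0 ∧ b = 0 := by omega
    rfl
  | succ s ih =>
    cases a with
    | zero => rw [gb_zero_right, Nat.zero_add, gb_self]
    | succ a =>
      cases b with
      | zero => rw [gb_zero_right, Nat.add_zero, gb_self]
      | succ b =>
        have h1 := ih a (b + 1) (by omega)
        have h2 := ih (a + 1) b (by omega)
        have e1 : a + 1 + (b + 1) = (a + (b + 1)) + 1 := by omega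
        have e2 : a + 1 + b = a + (b + 1) := by omega
        rw [e2] at h2
        rw [e1, gb_succ_succ, gb_succ_succ' (by omega : b ≤ a + (b + 1)), h1, h2,
          show a + (b + 1) - b = a + 1 by omega]
        ring

lemma qbin_natCast {m n : ℕ} : qbin m n = (gb m n).toLaurent := by
  unfold qbin
  split_ifs with h
  · simp
  · rw [gb_eq_zero_of_lt (by omega)]; simp

lemma qbin_of_neg {m n : ℤ} (h : n < 0) : qbin m n = 0 := if_neg (by omega)

lemma qbin_pascal (m : ℕ) (k : ℤ) :
    qbin ((m : ℤ) + 1) k = qbin m (k - 1) + T k * qbin m k := by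
  rcases lt_or_ge k 0 with hk | hk
  · rw [qbin_of_neg hk, qbin_of_neg hk, qbin_of_neg (by omega)]; simp
  lift k to ℕ using hk
  cases k with
  | zero =>
    rw [qbin_of_neg (n := ((0 : ℕ) : ℤ) - 1) (by simp)]
    have h1 := qbin_natCast (m := m + 1) (n := 0)
    have h2 := qbin_natCast (m := m) (n := 0)
    push_cast at h1 h2 ⊢
    rw [h1, h2, gb_zero_right, gb_zero_right]
    simp
  | succ n =>
    have h1 := qbin_natCast (m := m + 1) (n := n + 1)
    have h2 := qbin_natCast (m := m) (n := n + 1)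
    have h3 := qbin_natCast (m := m) (n := n)
    push_cast at h1 h2 ⊢
    rw [add_sub_cancel_right, h1, h2, h3, gb_succ_succ]
    simp

lemma qbin_symm (m : ℕ) (k : ℤ) : qbin m k = qbin m (m - k) := by
  by_cases h : 0 ≤ k ∧ k ≤ m
  · obtain ⟨a, rfl⟩ := Int.eq_ofNat_of_zero_le h.1
    obtain ⟨b, rfl⟩ := Nat.exists_eq_add_of_le (by omega : a ≤ m)
    rw [show ((a + b : ℕ) : ℤ) - (a : ℤ) = (b : ℤ) by push_cast; ring, qbin_natCast, qbin_natCast,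
      gb_symm]
  · unfold qbin
    rw [if_neg h, if_neg (by omega)]

end GaussianBinomial

section ThetaSum

lemma chi_add_add (j : ℤ) : chi j + chi (j + 1) + chi (j + 2) = 0 := by
  unfold chi
  grind

lemma chi_neg (j : ℤ) : chi (-j) = -chi j := by
  unfold chi
  grind

lemma chi_add_three (j : ℤ) : chi (j + 3) = chi j := by
  unfold chi
  grind

/-- The summand of `chiSum`. -/
def chiTerm (i : ℤ) (m : ℕ) (n j : ℤ) : LaurentPolynomial ℤ :=
  (chi (j + i) : LaurentPolynomial ℤ) * T (j ^ 2) * qbin m (n - 2 * j)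

/-- The sum `∑ⱼ χ(j + i) q^(j²) [m choose n - 2j]`. -/
def chiSum (i : ℤ) (m : ℕ) (n : ℤ) : LaurentPolynomial ℤ := ∑ᶠ j : ℤ, chiTerm i m n j

lemma chiTerm_support_finite (i : ℤ) (m : ℕ) (n : ℤ) :
    (Function.support (chiTerm i m n)).Finite := by
  refine (Set.finite_Icc (-(m : ℤ) - |n|) (m + |n|)).subset fun j hj => ?_
  by_contra hj'
  refine hj ?_
  have : qbin m (n - 2 * j) = 0 := by
    refine if_neg fun h => hj' ?_
    rw [Set.mem_Icc]
    constructor <;> cases abs_cases n <;> omega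
  rw [chiTerm, this, mul_zero]

lemma chiSum_pascal (i : ℤ) (m : ℕ) (n : ℤ) :
    chiSum i (m + 1) n = chiSum i m (n - 1) + T (n - 1) * chiSum (i + 1) m (n - 2) := by
  have h : ∀ j, chiTerm i (m + 1) n j = chiTerm i m (n - 1) j +
      T (n - 1) * chiTerm (i + 1) m (n - 2) (Equiv.subRight (1 : ℤ) j) := by
    intro j
    simp only [chiTerm, Equiv.subRight_apply]
    push_cast
    rw [qbin_pascal, show j - 1 + (i + 1) = j + i by ring,
      show n - 1 - 2 * j = n - 2 * j - 1 by ring,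
      show n - 2 - 2 * (j - 1) = n - 2 * j by ring]
    have : (T (j ^ 2) * T (n - 2 * j) : LaurentPolynomial ℤ) = T (n - 1) * T ((j - 1) ^ 2) := by
      rw [← T_add, ← T_add]; ring_nf
    linear_combination (chi (j + i) : LaurentPolynomial ℤ) * qbin m (n - 2 * j) * this
  have hf : (Function.support fun j =>
      chiTerm (i + 1) m (n - 2) (Equiv.subRight (1 : ℤ) j)).Finite :=
    (chiTerm_support_finite (i + 1) m (n - 2)).preimage (Equiv.injective _).injOn
  simp only [chiSum]
  rw [finsum_congr h, finsum_add_distrib (chiTerm_support_finite _ _ _)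
    (hf.subset fun j hj hj' => hj (by simp only [hj', mul_zero])),
    ← mul_finsum' _ _ hf, finsum_comp_equiv (Equiv.subRight (1 : ℤ))]

lemma chiSum_neg (i : ℤ) (m : ℕ) (n : ℤ) : chiSum (-i) m (m - n) = -chiSum i m n := by
  have h : ∀ j, chiTerm (-i) m (m - n) (Equiv.neg ℤ j) = -chiTerm i m n j := by
    intro j
    simp only [chiTerm, Equiv.neg_apply]
    rw [show -j + -i = -(j + i) by ring, chi_neg, neg_sq, qbin_symm m (n - 2 * j),
      show (m : ℤ) - n - 2 * -j = m - (n - 2 * j) by ring]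
    push_cast
    ring
  simp only [chiSum]
  rw [← finsum_comp_equiv (Equiv.neg ℤ), finsum_congr h, finsum_neg_distrib]

lemma chiSum_add_three (i : ℤ) (m : ℕ) (n : ℤ) : chiSum (i + 3) m n = chiSum i m n := by
  refine finsum_congr fun j => ?_
  rw [chiTerm, chiTerm, ← add_assoc, chi_add_three]

lemma chiSum_zero_add_one_add_two (m : ℕ) (n : ℤ) :
    chiSum 0 m n + chiSum 1 m n + chiSum 2 m n = 0 := by
  simp only [chiSum]
  have hf := fun i => chiTerm_support_finite i m n
  rw [← finsum_add_distrib (hf 0) (hf 1), ← finsum_add_distrib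
    (((hf 0).union (hf 1)).subset (Function.support_add _ _)) (hf 2), ← finsum_zero (M := LaurentPolynomial ℤ) (α := ℤ)]
  refine finsum_congr fun j => ?_
  have := congrArg (Int.cast (R := LaurentPolynomial ℤ)) (chi_add_add j)
  push_cast at this
  simp only [chiTerm, add_zero]
  linear_combination T (j ^ 2) * qbin m (n - 2 * j) * this

lemma chiSum_pascal' (i : ℤ) (m : ℕ) (n : ℤ) :
    chiSum i (m + 1) n = chiSum i m n + T (m - n) * chiSum (i - 1) m (n + 1) := by
  have h0 := chiSum_neg i (m + 1) n
  have h1 := chiSum_neg i m n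
  have h2 := chiSum_neg (i - 1) m (n + 1)
  rw [chiSum_pascal] at h0
  push_cast at h0
  rw [show (m : ℤ) + 1 - n - 1 = m - n by ring, show (m : ℤ) + 1 - n - 2 = m - (n + 1) by ring,
    show -i + 1 = -(i - 1) by ring] at h0
  linear_combination h0 - h1 - T (m - n) * h2

lemma T_natCast (n : ℕ) : (T (n : ℤ) : LaurentPolynomial ℤ) = T 1 ^ n := by
  rw [T_pow, mul_one]

lemma chiSum_two (m : ℕ) (n : ℤ) : chiSum 2 m n = -chiSum 1 m (m - n) := by
  have h := chiSum_neg (-2) m n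
  rw [show -(-2 : ℤ) = -1 + 3 by norm_num, chiSum_add_three] at h
  have h1 := chiSum_neg 1 m (m - n)
  have h2 := chiSum_add_three (-1) m n
  rw [sub_sub_cancel] at h1
  rw [← h1, ← h2]
  norm_num

lemma chiSum_zero (m : ℕ) (n : ℤ) : chiSum 0 m n = chiSum 1 m (m - n) - chiSum 1 m n := by
  linear_combination chiSum_zero_add_one_add_two m n - chiSum_two m n

lemma chiSum_zero_left_even (i k : ℤ) : chiSum i 0 (2 * k) = (chi (k + i) : LaurentPolynomial ℤ) * T (k ^ 2) := by
  rw [chiSum, finsum_eq_single _ k]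
  · simp [chiTerm, qbin, gb]
  · intro j hj
    rw [chiTerm, qbin, if_neg (by push_cast; omega), mul_zero]

lemma chiSum_zero_left_odd (i k : ℤ) : chiSum i 0 (2 * k + 1) = 0 := by
  rw [chiSum, ← finsum_zero (M := LaurentPolynomial ℤ) (α := ℤ)]
  refine finsum_congr fun j => ?_
  rw [chiTerm, qbin, if_neg (by push_cast; omega), mul_zero]

lemma chiSum_one_two_mul_add_two (n : ℕ) :
    chiSum 1 (2 * n + 2) (n + 2) = (1 - T 1 ^ (n + 1)) * chiSum 1 (2 * n + 1) (n + 1) := by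
  have h := chiSum_pascal 1 (2 * n + 1) (n + 2)
  rw [show (1 : ℤ) + 1 = 2 by norm_num, chiSum_two] at h
  push_cast at h
  rw [show (n : ℤ) + 2 - 1 = ((n + 1 : ℕ) : ℤ) by push_cast; ring, T_natCast,
    show (2 : ℤ) * n + 1 - (n + 2 - 2) = n + 1 by ring] at h
  push_cast at h
  rw [h]
  ring

lemma chiSum_one_two_mul_add_one (n : ℕ) :
    chiSum 1 (2 * n + 1) (n + 1) = chiSum 1 (2 * n) n - T 1 ^ n * chiSum 1 (2 * n) (n + 1) := by
  have h := chiSum_pascal 1 (2 * n) (n + 1)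
  rw [show (1 : ℤ) + 1 = 2 by norm_num, chiSum_two] at h
  push_cast at h
  rw [show (n : ℤ) + 1 - 1 = n by ring, T_natCast,
    show (2 : ℤ) * n - (n + 1 - 2) = n + 1 by ring] at h
  rw [h]
  ring

lemma chiSum_one_two_mul_add_two_self (n : ℕ) :
    chiSum 1 (2 * n + 2) (n + 1) = chiSum 1 (2 * n + 1) n + T 1 ^ (2 * n + 1) * chiSum 1 (2 * n) n
      - T 1 ^ n * chiSum 1 (2 * n) (n + 1) := by
  have h := chiSum_pascal 1 (2 * n + 1) (n + 1)
  rw [show (1 : ℤ) + 1 = 2 by norm_num, chiSum_two] at h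
  push_cast at h
  rw [show (n : ℤ) + 1 - 1 = n by ring, T_natCast,
    show (2 : ℤ) * n + 1 - (n + 1 - 2) = n + 2 by ring] at h
  have h' := chiSum_pascal 1 (2 * n) (n + 2)
  rw [show (1 : ℤ) + 1 = 2 by norm_num, chiSum_two] at h'
  push_cast at h'
  rw [show (n : ℤ) + 2 - 1 = ((n + 1 : ℕ) : ℤ) by push_cast; ring, T_natCast,
    show (2 : ℤ) * n - (n + 2 - 2) = n by ring] at h'
  push_cast at h'
  linear_combination h - T 1 ^ n * h'

lemma chiSum_one_two_mul_add_two_pred (n : ℕ) :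
    chiSum 1 (2 * n + 2) n = (1 + T 1 ^ (n + 1)) * chiSum 1 (2 * n + 1) n
      - T 1 ^ (n + 1) * chiSum 1 (2 * n + 1) (n + 1) := by
  have h := chiSum_pascal' 1 (2 * n + 1) n
  rw [show (1 : ℤ) - 1 = 0 by norm_num, chiSum_zero] at h
  push_cast at h
  rw [show (2 : ℤ) * n + 1 - n = ((n + 1 : ℕ) : ℤ) by push_cast; ring, T_natCast,
    show (2 : ℤ) * n + 1 - (n + 1) = n by ring] at h
  rw [h]
  ring

lemma chiSum_one_two_mul_add_one_self (n : ℕ) :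
    chiSum 1 (2 * n + 1) n = chiSum 1 (2 * n) n
      + T 1 ^ n * (chiSum 1 (2 * n) (n - 1) - chiSum 1 (2 * n) (n + 1)) := by
  have h := chiSum_pascal' 1 (2 * n) n
  rw [show (1 : ℤ) - 1 = 0 by norm_num, chiSum_zero] at h
  push_cast at h
  rw [show (2 : ℤ) * n - n = n by ring, T_natCast,
    show (2 : ℤ) * n - (n + 1) = n - 1 by ring] at h
  exact h

end ThetaSum

section Kernel

/-- The polynomials `∑ᵣ q^((k-2r)(k-2r-1)/2) [k choose 2r] ∏_{i=1}^{r} (1 - q^(2i-1) + q^(4i-2))`,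
given by their recurrence. -/
def kernel : ℕ → LaurentPolynomial ℤ
  | 0 => 1
  | 1 => 1
  | 2 => 1 + T 1 ^ 2
  | k + 3 => kernel (k + 2) + T 1 ^ (k + 2) * (kernel (k + 2) - kernel (k + 1)) +
      T 1 ^ (2 * k + 4) * kernel (k + 1) + T 1 ^ (2 * k + 3) * (1 - T 1 ^ (k + 1)) * kernel k

lemma kernel_isNonneg (k : ℕ) : IsNonneg (kernel k) := by
  suffices h : ∀ k, IsNonneg (kernel k) ∧ IsNonneg (kernel (k + 1)) ∧ IsNonneg (kernel (k + 2)) ∧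
      IsNonneg (kernel (k + 2) - kernel (k + 1) - T 1 ^ (2 * k + 2) * kernel k) from (h k).1
  intro k
  induction k with
  | zero =>
    have h2 : kernel 2 - kernel 1 - T 1 ^ 2 * kernel 0 = 0 := by simp only [kernel]; ring
    refine ⟨.one, .one, .add .one (.T_pow 2), ?_⟩
    exact h2 ▸ .zero
  | succ k ih =>
    obtain ⟨h0, h1, h2, h3⟩ := ih
    have hr : kernel (k + 3) - kernel (k + 2) - T 1 ^ (2 * k + 4) * kernel (k + 1) =
        T 1 ^ (k + 2) * (kernel (k + 2) - kernel (k + 1) - T 1 ^ (2 * k + 2) * kernel k) +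
          T 1 ^ (2 * k + 3) * kernel k := by
      rw [kernel]; ring
    have hr' : IsNonneg (kernel (k + 3) - kernel (k + 2) - T 1 ^ (2 * k + 4) * kernel (k + 1)) :=
      hr ▸ ((IsNonneg.T_pow _).mul h3).add ((IsNonneg.T_pow _).mul h0)
    refine ⟨h1, h2, ?_, hr'⟩
    have := (hr'.add h2).add ((IsNonneg.T_pow (2 * k + 4)).mul h1)
    convert this using 1
    ring

/-- The polynomial `∑ᵢ [N choose i] kernel (N - i) yⁱ` in `y`. -/
def kernelAppell (N : ℕ) : Polynomial (LaurentPolynomial ℤ) :=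
  ∑ i ∈ range (N + 1), Polynomial.monomial i ((gb N i).toLaurent * kernel (N - i))

lemma kernelAppell_coeff (N i : ℕ) :
    (kernelAppell N).coeff i = (gb N i).toLaurent * kernel (N - i) := by
  simp only [kernelAppell, Polynomial.finsetSum_coeff, Polynomial.coeff_monomial,
    Finset.sum_ite_eq', mem_range]
  split_ifs with h
  · rfl
  · rw [gb_eq_zero_of_lt (by omega)]; simp

lemma kernelAppell_eval_isNonneg (N M : ℕ) : IsNonneg ((kernelAppell N).eval (T 1 ^ M)) := by
  simp only [kernelAppell, Polynomial.eval_finsetSum, Polynomial.eval_monomial, ← pow_mul]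
  refine .sum _ _ fun i _ => (IsNonneg.mul ?_ (kernel_isNonneg _)).mul (.T_pow _)
  exact ⟨gb N i, gb_coeff_nonneg N i, rfl⟩

lemma kernelAppell_comp (N : ℕ) :
    (kernelAppell (N + 1)).comp (Polynomial.C (T 1) * Polynomial.X) =
      kernelAppell (N + 1) - (1 - Polynomial.C (T 1) ^ (N + 1)) * Polynomial.X * kernelAppell N := by
  ext1 i
  rw [Polynomial.comp_C_mul_X_coeff, Polynomial.coeff_sub, kernelAppell_coeff,
    show (1 - Polynomial.C (T 1) ^ (N + 1)) * Polynomial.X * kernelAppell N =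
      Polynomial.C (1 - T 1 ^ (N + 1)) * (Polynomial.X * kernelAppell N) by
      rw [map_sub, map_pow, map_one, mul_assoc],
    Polynomial.coeff_C_mul]
  cases i with
  | zero => simp
  | succ i =>
    rw [Polynomial.coeff_X_mul, kernelAppell_coeff, Nat.add_sub_add_right]
    have h := congrArg Polynomial.toLaurent (one_sub_X_pow_mul_gb N i)
    simp only [map_mul, map_sub, map_one, Polynomial.toLaurent_X_pow, T_natCast] at h
    linear_combination -kernel (N - i) * h

lemma eq_C_of_comp_eq {p : Polynomial (LaurentPolynomial ℤ)}
    (h : p.comp (Polynomial.C (T 1) * Polynomial.X) = p) : p = Polynomial.C (p.coeff 0) := by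
  ext1 i
  cases i with
  | zero => simp
  | succ i =>
    have hi := congrArg (Polynomial.coeff · (i + 1)) h
    simp only [Polynomial.comp_C_mul_X_coeff] at hi
    have hq : (T 1 ^ (i + 1) - 1 : LaurentPolynomial ℤ) ≠ 0 := by
      rw [sub_ne_zero, ← T_natCast, ← T_zero]
      intro hT
      have := congrArg (fun f : LaurentPolynomial ℤ => f.coeff 0) hT
      simp only [T_apply, if_true] at this
      rw [if_neg (by omega)] at this
      exact zero_ne_one this
    rw [Polynomial.coeff_C_succ]
    refine (mul_eq_zero.mp (?_ : (T 1 ^ (i + 1) - 1) * p.coeff (i + 1) = 0)).resolve_left hq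
    linear_combination hi

lemma kernelAppell_eval_zero (N : ℕ) : (kernelAppell N).eval 0 = kernel N := by
  rw [← Polynomial.coeff_zero_eq_eval_zero, kernelAppell_coeff, gb_zero_right]
  simp

lemma kernelAppell_recurrence (N : ℕ) :
    kernelAppell (N + 3) =
      (1 + (1 + Polynomial.C (T 1)) * Polynomial.X + Polynomial.C (T 1) ^ (N + 2)) *
        kernelAppell (N + 2)
      + (Polynomial.C (T 1) ^ (2 * N + 4) - Polynomial.C (T 1) ^ (N + 2)
        - (1 + Polynomial.C (T 1)) * Polynomial.X - Polynomial.C (T 1) * Polynomial.X ^ 2) *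
        kernelAppell (N + 1)
      + (1 - Polynomial.C (T 1) ^ (N + 1)) * (Polynomial.C (T 1) * Polynomial.X ^ 2
        + Polynomial.C (T 1) ^ (N + 2) * Polynomial.X + Polynomial.C (T 1) ^ (2 * N + 3)) *
        kernelAppell N := by
  rw [← sub_eq_zero]
  induction N with
  | zero =>
    simp only [kernelAppell, sum_range_succ, sum_range_zero, gb, kernel,
      ← Polynomial.C_mul_X_pow_eq_monomial, map_mul, map_add, map_sub, map_pow, map_one, map_zero,
      Polynomial.toLaurent_X, Nat.zero_add, Nat.sub_zero, Nat.sub_self, Nat.reduceAdd,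
      Nat.reduceSub]
    ring
  | succ N ih =>
    refine (eq_C_of_comp_eq ?_).trans ?_
    · simp only [Polynomial.sub_comp, Polynomial.add_comp, Polynomial.mul_comp,
        Polynomial.pow_comp, Polynomial.C_comp, Polynomial.X_comp, Polynomial.one_comp,
        kernelAppell_comp]
      linear_combination ((Polynomial.C (T 1) ^ (N + 4) - Polynomial.C (T 1) ^ 2) * Polynomial.X) * ih
    · rw [Polynomial.coeff_zero_eq_eval_zero]
      simp only [Polynomial.eval_sub, Polynomial.eval_add, Polynomial.eval_mul,
        Polynomial.eval_pow, Polynomial.eval_C, Polynomial.eval_X, Polynomial.eval_one,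
        kernelAppell_eval_zero]
      rw [kernel, ← map_zero Polynomial.C]
      congr 1
      ring

lemma kernelAppell_eval_succ (N M : ℕ) :
    (kernelAppell (N + 1)).eval (T 1 ^ (M + 1)) = (kernelAppell (N + 1)).eval (T 1 ^ M)
      - (1 - T 1 ^ (N + 1)) * T 1 ^ M * (kernelAppell N).eval (T 1 ^ M) := by
  have h := congrArg (Polynomial.eval (T 1 ^ M)) (kernelAppell_comp N)
  simp only [Polynomial.eval_comp, Polynomial.eval_sub, Polynomial.eval_mul, Polynomial.eval_pow,
    Polynomial.eval_C, Polynomial.eval_X, Polynomial.eval_one] at h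
  rw [pow_succ', h]

end Kernel

section Nonnegativity

lemma chiSum_eq_kernelAppell_eval (n : ℕ) :
    chiSum 1 (2 * n) n = (kernelAppell n).eval (T 1 ^ n) ∧
    chiSum 1 (2 * n + 1) (n + 1) = (kernelAppell n).eval (T 1 ^ (n + 1)) ∧
    chiSum 1 (2 * n + 2) (n + 1) = (kernelAppell (n + 1)).eval (T 1 ^ (n + 1)) := by
  induction n with
  | zero =>
    have hA : chiSum 1 0 0 = 1 := by simpa [chi] using chiSum_zero_left_even 1 0
    have hF : chiSum 1 0 1 = 0 := by simpa using chiSum_zero_left_odd 1 0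
    have hE : chiSum 1 0 (-1) = 0 := by simpa using chiSum_zero_left_odd 1 (-1)
    have hC := chiSum_one_two_mul_add_one 0
    have hA' := chiSum_one_two_mul_add_two_self 0
    have hB := chiSum_one_two_mul_add_one_self 0
    simp only [Nat.cast_zero, Nat.mul_zero, zero_add, zero_sub, hA, hF, hE] at hC hA' hB ⊢
    rw [hA', hB, hC]
    simp [kernelAppell, kernel, gb, sum_range_succ, add_comm]
  | succ n ih =>
    obtain ⟨hA, hC, hA'⟩ := ih
    have hC' := chiSum_one_two_mul_add_one (n + 1)
    have hF := chiSum_one_two_mul_add_two n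
    have hE := chiSum_one_two_mul_add_two_pred n
    have hB := chiSum_one_two_mul_add_two_self n
    have hFn := chiSum_one_two_mul_add_one n
    have hB' := chiSum_one_two_mul_add_one_self (n + 1)
    have hA'' := chiSum_one_two_mul_add_two_self (n + 1)
    push_cast at hC' hB' hA'' ⊢
    rw [show 2 * (n + 1) = 2 * n + 2 by ring] at *
    rw [show (n : ℤ) + 1 + 1 = n + 2 by ring] at *
    rw [add_sub_cancel_right] at hB'
    rw [hF, hA', hC] at hC'
    refine ⟨hA', ?_, ?_⟩
    · rw [hC', kernelAppell_eval_succ n (n + 1)]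
      ring
    · have hX : chiSum 1 (2 * n + 2 + 2) (n + 2) =
          (1 + T 1 ^ (n + 1) + T 1 ^ (2 * n + 2) + T 1 ^ (2 * n + 3)) *
            chiSum 1 (2 * n + 2) (n + 1)
          + T 1 ^ (n + 1) * (1 + T 1 ^ (n + 1)) * (1 - T 1 ^ (2 * n + 1)) * chiSum 1 (2 * n) n
          - 3 * T 1 ^ (n + 1) * chiSum 1 (2 * n + 1) (n + 1) := by
        linear_combination hA'' + hB' - 2 * T 1 ^ (n + 1) * hF + T 1 ^ (n + 1) * hE
          - T 1 ^ (n + 1) * (1 + T 1 ^ (n + 1)) * (hB - hFn)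
      rw [hX, hA', hA, hC]
      cases n with
      | zero =>
        simp only [kernelAppell, kernel, gb, sum_range_succ, sum_range_zero, Polynomial.eval_add,
          Polynomial.eval_zero, Polynomial.eval_monomial, map_add, map_mul, map_pow, map_one,
          map_zero, Polynomial.toLaurent_X, Nat.zero_add, Nat.sub_zero, Nat.sub_self, Nat.reduceAdd,
          Nat.reduceSub]
        ring
      | succ k =>
        have h := congrArg (Polynomial.eval (T 1 ^ (k + 1))) (kernelAppell_recurrence k)
        simp only [Polynomial.eval_add, Polynomial.eval_sub, Polynomial.eval_mul,
          Polynomial.eval_pow, Polynomial.eval_C, Polynomial.eval_X, Polynomial.eval_one] at h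
        simp only [kernelAppell_eval_succ _ (k + 2), kernelAppell_eval_succ _ (k + 1)]
        rw [h]
        ring

lemma chiSum_one_isNonneg (n : ℕ) :
    IsNonneg (chiSum 1 (2 * n) n) ∧ IsNonneg (chiSum 1 (2 * n + 1) (n + 1)) := by
  obtain ⟨hA, hC, -⟩ := chiSum_eq_kernelAppell_eval n
  rw [hA, hC]
  exact ⟨kernelAppell_eval_isNonneg _ _, kernelAppell_eval_isNonneg _ _⟩

lemma chiSum_one_two_mul_add_one_self_eq (n : ℕ) :
    chiSum 1 (2 * n + 1) n =
      chiSum 1 (2 * n + 1) (n + 1) + T 1 ^ n * chiSum 1 (2 * n) (n - 1) := by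
  linear_combination chiSum_one_two_mul_add_one_self n - chiSum_one_two_mul_add_one n

lemma chiSum_one_two_mul_pred_isNonneg (n : ℕ) : IsNonneg (chiSum 1 (2 * n) (n - 1)) := by
  induction n with
  | zero =>
    have h : chiSum 1 0 (-1) = 0 := by simpa using chiSum_zero_left_odd 1 (-1)
    simpa [h] using IsNonneg.zero
  | succ n ih =>
    have hB := chiSum_one_two_mul_add_one_self_eq n
    have hE : chiSum 1 (2 * n + 2) n =
        chiSum 1 (2 * n + 1) n + T 1 ^ (2 * n + 1) * chiSum 1 (2 * n) (n - 1) := by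
      linear_combination chiSum_one_two_mul_add_two_pred n + T 1 ^ (n + 1) * hB
    rw [Nat.cast_succ, add_sub_cancel_right]
    change IsNonneg (chiSum 1 (2 * n + 2) n)
    rw [hE, hB]
    exact ((chiSum_one_isNonneg n).2.add ((IsNonneg.T_pow _).mul ih)).add
      ((IsNonneg.T_pow _).mul ih)

end Nonnegativity

/-- `D_{6,2}(N+a,N;1,1/2) = ∑_{j ∈ ℤ} χ(j+1) q^{j²} [2N+a choose N-2j]_q` has
nonnegative coefficients for `a ∈ {0,1}`. -/
theorem example_i_nonneg (N a : ℕ) (ha : a = 0 ∨ a = 1) :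
    IsNonneg (∑ᶠ j : ℤ,
      ((chi (j + 1) : ℤ) : LaurentPolynomial ℤ) * T (j ^ 2) *
        qbin (2 * N + a) ((N : ℤ) - 2 * j)) := by
  rcases ha with rfl | rfl
  · exact (chiSum_one_isNonneg N).1
  · have h : IsNonneg (chiSum 1 (2 * N + 1) N) := by
      rw [chiSum_one_two_mul_add_one_self_eq]
      exact (chiSum_one_isNonneg N).2.add
        ((IsNonneg.T_pow _).mul (chiSum_one_two_mul_pred_isNonneg N))
    exact h
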